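/- Let g : [0, h₀] → ℝ^m be real-analytic in a neighborhood of 0, and let P̂_j be the j-th orthonormal shifted Legendre polynomial on [0,1]. Then for every j ≥ 0, the integral ∫₀¹ P̂_j(τ) g(τh) dτ is O(h^j) as h → 0⁺; that is, there exist constants C > 0 and h₁ ∈ (0, h₀] such that ‖∫₀¹ P̂_j(τ) g(τh) dτ‖ ≤ C h^j for all h ∈ (0, h₁]. -/

import Mathlib

open Set Polynomial

/-- In a sequence of polynomials of degrees `0, 1, 2, …` whose members are pairwise orthogonal on
`[a, b]`, the `j`-th one is orthogonal to every polynomial of degree less than `j`. -/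
theorem Polynomial.Sequence.integral_mul_eq_zero_of_degree_lt
    (S : Polynomial.Sequence ℝ) {a b : ℝ} {j : ℕ}
    (hS : ∀ i < j, (∫ x in a..b, (S j).eval x * (S i).eval x) = 0)
    {q : Polynomial ℝ} (hq : q.degree < j) :
    (∫ x in a..b, (S j).eval x * q.eval x) = 0 := by
  have hint (r : Polynomial ℝ) :
      IntervalIntegrable (fun x => (S j).eval x * r.eval x) MeasureTheory.volume a b :=
    ((S j).continuous.mul r.continuous).intervalIntegrable a b
  have hmem : q ∈ Submodule.span ℝ (S '' Set.Iio j) := by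
    rw [S.span_degreeLT fun i _ => (leadingCoeff_ne_zero.mpr (S.ne_zero i)).isUnit]
    exact mem_degreeLT.mpr hq
  clear hq
  induction hmem using Submodule.span_induction with
  | mem r hr =>
    obtain ⟨i, hi, rfl⟩ := hr
    exact hS i hi
  | zero => simp
  | add r s _ _ hr hs =>
    simp only [eval_add, mul_add]
    rw [intervalIntegral.integral_add (hint r) (hint s)]
    rw [hr, hs, add_zero]
  | smul c r _ hr =>
    simp only [eval_smul, smul_eq_mul, mul_left_comm _ c]
    rw [intervalIntegral.integral_const_mul]
    rw [hr, mul_zero]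

/-- A polynomial orthogonal on `[a, b]` to all monomials of degree less than `n` is orthogonal to
the rescaled partial sums of order `n` of a one-variable power series. -/
theorem integral_eval_smul_partialSum_eq_zero {E : Type*} [NormedAddCommGroup E]
    [NormedSpace ℝ E] [CompleteSpace E] (p : FormalMultilinearSeries ℝ ℝ E)
    (Q : Polynomial ℝ) {a b : ℝ} {n : ℕ}
    (hQ : ∀ k < n, (∫ x in a..b, Q.eval x * x ^ k) = 0) (h : ℝ) :
    (∫ x in a..b, Q.eval x • p.partialSum n (x * h)) = 0 := by
  have hterm (k : ℕ) (x : ℝ) : Q.eval x • (p k fun _ => x * h) =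
      (Q.eval x * x ^ k) • (h ^ k • p.coeff k) := by
    rw [p.apply_eq_pow_smul_coeff, mul_pow, smul_smul, smul_smul, mul_assoc]
  simp only [FormalMultilinearSeries.partialSum, Finset.smul_sum, hterm]
  rw [intervalIntegral.integral_finsetSum fun k _ =>
    Continuous.intervalIntegrable (by fun_prop) a b]
  refine Finset.sum_eq_zero fun k hk => ?_
  rw [intervalIntegral.integral_smul_const, hQ k (Finset.mem_range.mp hk), zero_smul]

/-- If `g` is real-analytic in a neighborhood of `0` and `P j` is the `j`-th
orthonormal shifted Legendre polynomial on `[0,1]`, then `∫₀¹ P_j(τ) g(τh) dτ = O(h^j)`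
as `h → 0⁺`. -/
theorem legendre_coefficient_bigO
    (m : ℕ) (h₀ : ℝ) (hh₀ : 0 < h₀)
    (P : ℕ → Polynomial ℝ)
    (hPdeg : ∀ j, (P j).degree = j)
    (hPorth : ∀ i j, (∫ x in (0:ℝ)..1, (P i).eval x * (P j).eval x) = if i = j then (1:ℝ) else 0)
    (hP0 : P 0 = 1)
    (g : ℝ → EuclideanSpace ℝ (Fin m))
    (hg : AnalyticAt ℝ g 0)
    (j : ℕ) :
    ∃ C > (0:ℝ), ∃ h₁, 0 < h₁ ∧ h₁ ≤ h₀ ∧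
      ∀ h, 0 < h → h ≤ h₁ →
        ‖∫ τ in (0:ℝ)..1, (P j).eval τ • g (τ * h)‖ ≤ C * h ^ j := by
  have horth (k : ℕ) (hk : k < j) : (∫ x in (0:ℝ)..1, (P j).eval x * x ^ k) = 0 := by
    simpa using Polynomial.Sequence.integral_mul_eq_zero_of_degree_lt ⟨P, hPdeg⟩
      (fun i hi => (hPorth j i).trans (if_neg hi.ne'))
      (q := X ^ k) (by simpa using hk)
  obtain ⟨p, hp⟩ := id hg
  obtain ⟨c, hc, hbound⟩ := (hp.isBigO_sub_partialSum_pow j).exists_pos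
  obtain ⟨ε, hε, hball⟩ := Metric.eventually_nhds_iff.mp
    (hbound.bound.and hg.eventually_analyticAt)
  obtain ⟨M, hM⟩ := (isCompact_Icc (a := (0:ℝ)) (b := 1)).exists_bound_of_continuousOn
    (P j).continuous.continuousOn
  have hM0 : 0 ≤ M := (norm_nonneg _).trans (hM 0 (by simp))
  refine ⟨(M + 1) * c, by positivity, min h₀ (ε / 2), by positivity, min_le_left _ _,
    fun h hpos hle => ?_⟩
  have hlt : h < ε := by linarith [hle.trans (min_le_right _ _)]
  have hscale {τ : ℝ} (hτ : τ ∈ Icc (0:ℝ) 1) : ‖τ * h‖ ≤ h := by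
    rw [Real.norm_of_nonneg (mul_nonneg hτ.1 hpos.le)]
    exact mul_le_of_le_one_left hpos.le hτ.2
  have hnear {τ : ℝ} (hτ : τ ∈ Icc (0:ℝ) 1) : dist (τ * h) 0 < ε := by
    rw [dist_zero_right]
    exact (hscale hτ).trans_lt hlt
  have hg_int : IntervalIntegrable (fun τ => (P j).eval τ • g (τ * h))
      MeasureTheory.volume 0 1 := by
    refine ContinuousOn.intervalIntegrable_of_Icc zero_le_one
      ((P j).continuous.continuousOn.smul fun τ hτ => ?_)
    exact ((hball (hnear hτ)).2.continuousAt.comp (f := fun τ : ℝ => τ * h)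
      (by fun_prop)).continuousWithinAt
  have hp_int : IntervalIntegrable (fun τ => (P j).eval τ • p.partialSum j (τ * h))
      MeasureTheory.volume 0 1 :=
    ((P j).continuous.smul ((p.partialSum_continuous j).comp
      (continuous_mul_const h))).intervalIntegrable 0 1
  have hsub : (∫ τ in (0:ℝ)..1, (P j).eval τ • g (τ * h)) =
      ∫ τ in (0:ℝ)..1, (P j).eval τ • (g (τ * h) - p.partialSum j (τ * h)) := by
    simp only [smul_sub]
    rw [intervalIntegral.integral_sub hg_int hp_int,
      integral_eval_smul_partialSum_eq_zero p (P j) horth, sub_zero]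
  rw [hsub]
  refine (intervalIntegral.norm_integral_le_of_norm_le_const
    (C := (M + 1) * c * h ^ j) fun τ hτ => ?_).trans_eq (by simp)
  rw [uIoc_of_le zero_le_one] at hτ
  have hτ' := Ioc_subset_Icc_self hτ
  have hrem : ‖g (τ * h) - p.partialSum j (τ * h)‖ ≤ c * h ^ j := by
    have hle_norm := (hball (hnear hτ')).1
    rw [zero_add, norm_pow, norm_norm] at hle_norm
    exact hle_norm.trans (by gcongr; exact hscale hτ')
  rw [norm_smul, mul_assoc]
  gcongr
  linarith [hM τ hτ']
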